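/- arXiv:2308.13457 — 3 statements merged into one kernel-verified Lean document; each statement's English description precedes it below -/
import Mathlib

section
/- For all nonnegative integers r and n, the generalized FiboCatalan number J_{r,F}·F_{2n}!/(F_n!·F_{n+r+1}!) with J_{r,F} = F_{2r+1}!/F_r! is a positive integer; that is, F_r!·F_n!·F_{n+r+1}! divides F_{2r+1}!·F_{2n}!. -/
/-- The Fibonacci factorial `F_n! = F_n F_{n-1} ⋯ F_2 F_1`, with `F_0! = 1`. -/
def fibFact : ℕ → ℕ
  | 0 => 1
  | n + 1 => Nat.fib (n + 1) * fibFact n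

theorem fibFact_pos (n : ℕ) : 0 < fibFact n := by
  induction n with
  | zero => simp [fibFact]
  | succ n ih => exact Nat.mul_pos (Nat.fib_pos.2 n.succ_pos) ih

/-- the number of `1 ≤ m ≤ n` with `q ∣ F_m` -/
def cntF (q n : ℕ) : ℕ := ∑ m ∈ Finset.range n, if q ∣ Nat.fib (m + 1) then 1 else 0

theorem cntF_cases (q : ℕ) : (∀ n, cntF q n = 0) ∨ ∃ d, 0 < d ∧ ∀ n, cntF q n = n / d := by
  classical
  by_cases h : ∃ d, 0 < d ∧ q ∣ Nat.fib d
  · right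
    obtain ⟨hd, hq⟩ := Nat.find_spec h
    have hmin : ∀ m, 0 < m → q ∣ Nat.fib m → Nat.find h ≤ m := fun m h1 h2 =>
      Nat.find_min' h ⟨h1, h2⟩
    generalize Nat.find h = d at hd hq hmin
    refine ⟨d, hd, fun n => ?_⟩
    have key : ∀ m, q ∣ Nat.fib (m + 1) ↔ d ∣ m + 1 := by
      intro m
      constructor
      · intro hm
        have h1 : q ∣ Nat.fib (Nat.gcd d (m + 1)) := by
          rw [Nat.fib_gcd]; exact Nat.dvd_gcd hq hm
        have h2 := hmin _ (Nat.gcd_pos_of_pos_left _ hd) h1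
        have h3 : Nat.gcd d (m + 1) = d := le_antisymm (Nat.gcd_le_left _ hd) h2
        rw [← h3]; exact Nat.gcd_dvd_right _ _
      · intro hm
        exact hq.trans (Nat.fib_dvd _ _ hm)
    induction n with
    | zero => simp [cntF]
    | succ n ih =>
      have : cntF q (n + 1) = cntF q n + if q ∣ Nat.fib (n + 1) then 1 else 0 :=
        Finset.sum_range_succ _ _
      rw [this, ih, Nat.succ_div]
      simp only [key]
  · left
    intro n
    apply Finset.sum_eq_zero
    intro m _
    rw [if_neg]
    exact fun hm => h ⟨m + 1, m.succ_pos, hm⟩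

theorem div_ineq (r n d : ℕ) (hd : 0 < d) :
    r / d + n / d + (n + r + 1) / d ≤ (2 * r + 1) / d + (2 * n) / d := by
  have hr := Nat.div_add_mod r d
  have hn := Nat.div_add_mod n d
  have ha := Nat.mod_lt r hd
  have hb := Nat.mod_lt n hd
  generalize r / d = x at *
  generalize n / d = y at *
  generalize r % d = a at *
  generalize n % d = b at *
  subst hr hn
  have e1 : d * y + b + (d * x + a) + 1 = (a + b + 1) + d * (x + y) := by ring
  have e2 : 2 * (d * x + a) + 1 = (2 * a + 1) + d * (2 * x) := by ring
  have e3 : 2 * (d * y + b) = 2 * b + d * (2 * y) := by ring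
  rw [e1, e2, e3, Nat.add_mul_div_left _ _ hd, Nat.add_mul_div_left _ _ hd,
    Nat.add_mul_div_left _ _ hd]
  suffices (a + b + 1) / d ≤ (2 * a + 1) / d + (2 * b) / d by omega
  have h2 : (a + b + 1) / d < 2 := (Nat.div_lt_iff_lt_mul hd).2 (by omega)
  by_cases h : a + b + 1 < d
  · simp [Nat.div_eq_of_lt h]
  · by_cases h' : d ≤ 2 * a + 1
    · have := Nat.div_pos h' hd
      exact (Nat.le_of_lt_succ h2).trans (Nat.le_add_right_of_le this)
    · have := Nat.div_pos (show d ≤ 2 * b by omega) hd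
      exact (Nat.le_of_lt_succ h2).trans (Nat.le_add_left_of_le this)

theorem cntF_ineq (q r n : ℕ) :
    cntF q r + cntF q n + cntF q (n + r + 1) ≤ cntF q (2 * r + 1) + cntF q (2 * n) := by
  rcases cntF_cases q with h | ⟨d, hd, h⟩
  · simp [h]
  · simp only [h]; exact div_ineq r n d hd

theorem fact_fibFact (p : ℕ) (hp : p.Prime) (n B : ℕ) (hB : Nat.fib n < B) :
    (fibFact n).factorization p = ∑ i ∈ Finset.Ico 1 B, cntF (p ^ i) n := by
  induction n with
  | zero => simp [cntF, fibFact]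
  | succ n ih =>
    have hpos : 0 < Nat.fib (n + 1) := Nat.fib_pos.2 n.succ_pos
    have e : ∀ q, cntF q (n + 1) = cntF q n + if q ∣ Nat.fib (n + 1) then 1 else 0 :=
      fun q => Finset.sum_range_succ _ _
    have h1 := Nat.emultiplicity_eq_card_pow_dvd hp.ne_one hpos
      (lt_of_le_of_lt (Nat.log_le_self p _) hB)
    haveI := Fact.mk hp
    rw [← padicValNat_eq_emultiplicity hpos.ne', ← Nat.factorization_def _ hp] at h1
    have h2 : (Nat.fib (n + 1)).factorization p
      = Finset.card {i ∈ Finset.Ico 1 B | p ^ i ∣ Nat.fib (n + 1)} := by exact_mod_cast h1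
    simp only [e, Finset.sum_add_distrib]
    rw [← ih (lt_of_le_of_lt Nat.fib_le_fib_succ hB), fibFact,
      Nat.factorization_mul hpos.ne' (fibFact_pos n).ne', Finsupp.add_apply, h2,
      Finset.card_filter, add_comm]

/-- The generalized FiboCatalan number `J_{r,F}·F_{2n}!/(F_n!·F_{n+r+1}!)` with
`J_{r,F} = F_{2r+1}!/F_r!` is a positive integer:
`F_r!·F_n!·F_{n+r+1}!` divides `F_{2r+1}!·F_{2n}!`. -/
theorem generalizedFiboCatalan_int (r n : ℕ) :
    fibFact r * fibFact n * fibFact (n + r + 1) ∣ fibFact (2 * r + 1) * fibFact (2 * n) := by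
  have P := fun n => (fibFact_pos n).ne'
  rw [← Nat.factorization_prime_le_iff_dvd (mul_ne_zero (mul_ne_zero (P _) (P _)) (P _))
    (mul_ne_zero (P _) (P _))]
  intro p hp
  rw [Nat.factorization_mul (mul_ne_zero (P _) (P _)) (P _), Nat.factorization_mul (P _) (P _),
    Nat.factorization_mul (P _) (P _)]
  simp only [Finsupp.add_apply]
  have hB : ∀ m, m ≤ 2 * r + 2 * n + 1 → Nat.fib m < Nat.fib (2 * r + 2 * n + 1) + 1 :=
    fun m hm => Nat.lt_succ_of_le (Nat.fib_mono hm)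
  rw [fact_fibFact p hp r _ (hB _ (by omega)), fact_fibFact p hp n _ (hB _ (by omega)),
    fact_fibFact p hp (n + r + 1) _ (hB _ (by omega)),
    fact_fibFact p hp (2 * r + 1) _ (hB _ (by omega)),
    fact_fibFact p hp (2 * n) _ (hB _ (by omega)),
    ← Finset.sum_add_distrib, ← Finset.sum_add_distrib, ← Finset.sum_add_distrib]
  exact Finset.sum_le_sum fun i _ => cntF_ineq _ r n
end

section
/- For every integer n ≥ 1, if gcd(2n+1, n+2) = 3 then F_{n+2} divides 2·C_{n,F}, where C_{n,F} is the FiboCatalan number; that is, F_{n+2}·F_{n+1}!·F_n! divides 2·F_{2n}!. -/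
theorem fibFact_mul_dvd : ∀ a b : ℕ, fibFact a * fibFact b ∣ fibFact (a + b)
  | 0, b => by simp [fibFact]
  | a + 1, 0 => by simp [fibFact]
  | a + 1, b + 1 => by
    have h1 := fibFact_mul_dvd a (b + 1)
    have h2 := fibFact_mul_dvd (a + 1) b
    have e1 : a + 1 + (b + 1) = (a + b + 1) + 1 := by ring
    have e2 : a + 1 + b = a + b + 1 := by ring
    have e3 : a + (b + 1) = a + b + 1 := by ring
    have hf : Nat.fib (a + b + 1 + 1) =
        Nat.fib (a + 1) * Nat.fib b + Nat.fib (a + 1 + 1) * Nat.fib (b + 1) := by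
      rw [← Nat.fib_add]; congr 1; ring
    rw [e3] at h1
    rw [e2] at h2
    rw [e1, fibFact.eq_2 (a + b + 1), hf, add_mul]
    apply dvd_add
    · have := mul_dvd_mul_left (Nat.fib (a + 1)) h1
      rw [← mul_assoc, ← fibFact.eq_2 a] at this
      exact this.trans ⟨Nat.fib b, by ring⟩
    · have := mul_dvd_mul_left (Nat.fib (b + 1)) h2
      have e : Nat.fib (b + 1) * (fibFact (a + 1) * fibFact b)
          = fibFact (a + 1) * fibFact (b + 1) := by
        rw [fibFact.eq_2 b]; ring
      rw [e] at this
      exact this.trans ⟨Nat.fib (a + 1 + 1), by ring⟩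
  termination_by a b => a + b

theorem dvd_of_gcd {B x y A : ℕ} (h1 : B ∣ x * A) (h2 : B ∣ y * A) : B ∣ Nat.gcd x y * A := by
  rw [← Nat.gcd_mul_right]; exact Nat.dvd_gcd h1 h2

/-- For `n ≥ 1`, if `gcd (2n+1) (n+2) = 3` then `F_{n+2}` divides `2·C_{n,F}`, where
`C_{n,F} = F_{2n}!/(F_{n+1}!·F_n!)`: `F_{n+2}·F_{n+1}!·F_n!` divides `2·F_{2n}!`. -/
theorem fib_dvd_two_mul_fiboCatalan (n : ℕ) (hn : 1 ≤ n)
    (h : Nat.gcd (2 * n + 1) (n + 2) = 3) :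
    Nat.fib (n + 2) * fibFact (n + 1) * fibFact n ∣ 2 * fibFact (2 * n) := by
  obtain ⟨m, rfl⟩ : ∃ m, n = m + 1 := ⟨n - 1, by omega⟩
  have b1 := fibFact_mul_dvd (m + 1) (m + 1)
  have b2 := fibFact_mul_dvd (m + 2) m
  have b3 := fibFact_mul_dvd (m + 3) m
  rw [show m + 1 + (m + 1) = 2 * (m + 1) by ring] at b1
  rw [show m + 2 + m = 2 * (m + 1) by ring] at b2
  rw [show m + 3 + m = 2 * (m + 1) + 1 by ring, fibFact.eq_2 (2 * (m + 1)),
    fibFact.eq_2 (m + 2)] at b3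
  have c1 : fibFact (m + 2) * fibFact (m + 1) ∣ Nat.fib (m + 2) * fibFact (2 * (m + 1)) := by
    rw [fibFact.eq_2 (m + 1), mul_assoc]
    exact mul_dvd_mul_left _ b1
  have c2 : fibFact (m + 2) * fibFact (m + 1) ∣ Nat.fib (m + 1) * fibFact (2 * (m + 1)) := by
    rw [fibFact.eq_2 m, mul_left_comm]
    exact mul_dvd_mul_left _ b2
  have c := dvd_of_gcd c1 c2
  rw [Nat.gcd_comm, (Nat.fib_coprime_fib_succ (m + 1)).gcd_eq_one, one_mul] at c
  have d1 : Nat.fib (m + 3) * fibFact (m + 2) * fibFact (m + 1) ∣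
      Nat.fib (m + 3) * fibFact (2 * (m + 1)) := by
    rw [mul_assoc]; exact mul_dvd_mul_left _ c
  have d2 : Nat.fib (m + 3) * fibFact (m + 2) * fibFact (m + 1) ∣
      (Nat.fib (m + 1) * Nat.fib (2 * (m + 1) + 1)) * fibFact (2 * (m + 1)) := by
    rw [fibFact.eq_2 m, mul_left_comm, mul_assoc (Nat.fib (m + 1))]
    exact mul_dvd_mul_left _ b3
  have d := dvd_of_gcd d1 d2
  have g1 : Nat.Coprime (Nat.fib (m + 3)) (Nat.fib (m + 1)) := by
    have h4 := Nat.fib_add_two (n := m + 1)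
    have h5 := Nat.fib_coprime_fib_succ (m + 1)
    rw [show m + 3 = m + 1 + 2 by ring, h4]
    simpa using h5.symm
  have g2 : Nat.gcd (Nat.fib (m + 3)) (Nat.fib (2 * (m + 1) + 1)) = 2 := by
    rw [← Nat.fib_gcd, Nat.gcd_comm, show m + 3 = m + 1 + 2 by ring, h]; rfl
  rw [Nat.Coprime.gcd_mul_left_cancel_right _ g1.symm, g2] at d
  exact d
end

section
/- For every integer k ≥ 1 and all nonnegative integers m and n, the k-divisible Lucanomial analogue of the super Catalan number S{m,n:k} = {2m:k}!·{2n:k}!/({m:k}!·{n:k}!·{m+n:k}!) is a polynomial with nonnegative integer coefficients; that is, there exists a polynomial p in ℤ[s,t], all of whose coefficients are nonnegative, such that {2m:k}!·{2n:k}! = p·{m:k}!·{n:k}!·{m+n:k}!. -/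
open MvPolynomial

/-- The Lucas polynomials in `ℤ[s,t]` (with `s = X 0`, `t = X 1`):
`{0} = 0`, `{1} = 1`, `{n} = s{n−1} + t{n−2}` for `n ≥ 2`. -/
noncomputable def lucas : ℕ → MvPolynomial (Fin 2) ℤ
  | 0 => 0
  | 1 => 1
  | n + 2 => X 0 * lucas (n + 1) + X 1 * lucas n

/-- The Lucas factorial `{n}! = {n}{n−1}⋯{2}{1}`, with `{0}! = 1`. -/
noncomputable def lucasFact : ℕ → MvPolynomial (Fin 2) ℤ
  | 0 => 1
  | n + 1 => lucas (n + 1) * lucasFact n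

/-- The `k`-divisible Lucas factorial `{n:k}! = {k}{2k}⋯{nk}`, with `{0:k}! = 1`. -/
noncomputable def kLucasFact (k : ℕ) : ℕ → MvPolynomial (Fin 2) ℤ
  | 0 => 1
  | n + 1 => lucas ((n + 1) * k) * kLucasFact k n

lemma aux_U_prod (n : ℕ) (x : ℝ) : (Polynomial.Chebyshev.U ℝ n).eval x =
    2 ^ n * ∏ j ∈ Finset.range n, (x - Real.cos ((j + 1) * Real.pi / (n + 1))) := by
  have hr := Polynomial.Chebyshev.roots_U_real n
  have hinj := (Finset.range n).nodup_map_iff_injOn.mp (Polynomial.Chebyshev.roots_U_real_nodup n)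
  have hc : Multiset.card (Polynomial.Chebyshev.U ℝ n).roots
      = (Polynomial.Chebyshev.U ℝ n).natDegree := by
    rw [hr, Polynomial.Chebyshev.natDegree_U_natCast, Finset.card_val,
      Finset.card_image_of_injOn hinj, Finset.card_range]
  have h := Polynomial.C_leadingCoeff_mul_prod_multiset_X_sub_C hc
  rw [hr, Polynomial.Chebyshev.leadingCoeff_U_natCast] at h
  rw [← h, Polynomial.eval_mul, Polynomial.eval_C]
  congr 1
  change Polynomial.eval x (∏ a ∈ Finset.image _ _, _) = _
  rw [Finset.prod_image hinj, Polynomial.eval_prod]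
  simp

lemma aux_lucas_eval (s r : ℝ) (hr : r ≠ 0) (n : ℕ) :
    eval ![s, -r ^ 2] (map (Int.castRingHom ℝ) (lucas (n + 1))) =
      r ^ n * (Polynomial.Chebyshev.U ℝ n).eval (s / (2 * r)) := by
  induction n using Nat.twoStepInduction with
  | zero => simp [lucas]
  | one => simp [lucas]; field_simp
  | more n h1 h2 =>
    rw [lucas]
    simp only [map_add, map_mul, map_X, eval_X, h1, h2]
    push_cast
    rw [Polynomial.Chebyshev.U_add_two]
    simp
    field_simp
    ring

lemma aux_lucas_prod (s r : ℝ) (hr : r ≠ 0) (n : ℕ) (hn : 1 ≤ n) :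
    eval ![s, -r ^ 2] (map (Int.castRingHom ℝ) (lucas n)) =
      ∏ j ∈ Finset.Ico 1 n, (s - 2 * r * Real.cos (Real.pi * (j / n))) := by
  obtain ⟨n, rfl⟩ := Nat.exists_eq_add_of_le' hn
  rw [aux_lucas_eval s r hr, aux_U_prod, Finset.prod_Ico_eq_prod_range, ← mul_assoc, ← mul_pow]
  have : (r * 2) ^ n = ∏ j ∈ Finset.range n, (r * 2) := by simp
  rw [this, ← Finset.prod_mul_distrib]
  refine Finset.prod_congr (by simp) fun j _ => ?_
  rw [mul_sub]
  congr 1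
  · field_simp
  · push_cast
    rw [show (Real.pi * ((1 + j) / (n + 1)) : ℝ) = (j + 1) * Real.pi / (n + 1) by ring]
    ring

noncomputable def auxG (q : ℚ) : MvPolynomial (Fin 2) ℝ :=
  if q = 1 / 2 then X 0 else X 0 ^ 2 + C (4 * Real.cos (Real.pi * q) ^ 2) * X 1

def auxA (n : ℕ) : Finset ℚ :=
  ((Finset.Ico 1 n).filter (fun j => 2 * j ≤ n)).image (fun j : ℕ => (j : ℚ) / n)

lemma aux_mem {n : ℕ} (hn : 1 ≤ n) (q : ℚ) :
    q ∈ auxA n ↔ 0 < q ∧ q ≤ 1 / 2 ∧ q.den ∣ n := by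
  have hn0 : (0 : ℚ) < n := by exact_mod_cast hn
  simp only [auxA, Finset.mem_image, Finset.mem_filter, Finset.mem_Ico]
  constructor
  · rintro ⟨j, ⟨⟨h1, h2⟩, h3⟩, rfl⟩
    have hj : (0 : ℚ) < j := by exact_mod_cast h1
    have h3' : (2 * j : ℚ) ≤ n := by exact_mod_cast h3
    refine ⟨by positivity, ?_, ?_⟩
    · rw [div_le_div_iff₀ hn0 two_pos]; linarith
    · have := Rat.den_dvd (j : ℤ) (n : ℤ)
      rw [Rat.divInt_eq_div] at this
      exact Int.natCast_dvd_natCast.mp this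
  · rintro ⟨h0, h1, c, hc⟩
    have hnum : 0 < q.num := Rat.num_pos.mpr h0
    obtain ⟨a, ha⟩ := Int.eq_ofNat_of_zero_le hnum.le
    have hden : (0 : ℚ) < q.den := by exact_mod_cast q.pos
    have hq : q = a / q.den := by
      conv_lhs => rw [← Rat.num_div_den q, ha]
      simp
    have hc0 : 0 < c := by
      rcases Nat.eq_zero_or_pos c with rfl | h
      · omega
      · exact h
    have ha0 : 0 < a := by omega
    have h2 : 2 * a ≤ q.den := by
      rw [hq, div_le_div_iff₀ hden two_pos] at h1
      have : (a * 2 : ℚ) ≤ q.den := by linarith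
      have : a * 2 ≤ q.den := by exact_mod_cast this
      omega
    have h4 : 2 * (a * c) ≤ n := by rw [hc]; nlinarith
    have h5 : 0 < a * c := Nat.mul_pos ha0 hc0
    refine ⟨a * c, ⟨⟨h5, by omega⟩, h4⟩, ?_⟩
    have hc0' : (0 : ℚ) < c := by exact_mod_cast hc0
    have hnn : (n : ℚ) = q.den * c := by exact_mod_cast hc
    rw [hnn]
    conv_rhs => rw [hq]
    push_cast
    field_simp

lemma aux_pair (n : ℕ) (h : ℕ → ℝ) :
    ∏ j ∈ Finset.Ico 1 n, h j = ∏ j ∈ (Finset.Ico 1 n).filter (fun j => 2 * j ≤ n),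
      (if 2 * j = n then h j else h j * h (n - j)) := by
  rw [← Finset.prod_filter_mul_prod_filter_not (Finset.Ico 1 n) (fun j => 2 * j ≤ n)]
  have : ∏ j ∈ (Finset.Ico 1 n).filter (fun j => ¬ 2 * j ≤ n), h j =
      ∏ j ∈ (Finset.Ico 1 n).filter (fun j => 2 * j ≤ n), (if 2 * j = n then 1 else h (n - j)) := by
    rw [Finset.prod_ite, Finset.prod_const_one, one_mul]
    refine Finset.prod_nbij' (fun j => n - j) (fun j => n - j) ?_ ?_ ?_ ?_ ?_
    · intro j hj; simp at hj ⊢; omega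
    · intro j hj; simp at hj ⊢; omega
    · intro j hj; simp at hj ⊢; omega
    · intro j hj; simp at hj ⊢; omega
    · intro j hj; simp at hj ⊢; congr 1; omega
  rw [this, ← Finset.prod_mul_distrib]
  refine Finset.prod_congr rfl fun j _ => ?_
  split_ifs <;> simp

lemma aux_lucas_fac (n : ℕ) (hn : 1 ≤ n) :
    map (Int.castRingHom ℝ) (lucas n) = ∏ q ∈ auxA n, auxG q := by
  have hn0 : (0 : ℝ) < n := by exact_mod_cast hn
  have hn0q : (0 : ℚ) < n := by exact_mod_cast hn
  refine funext_set (fun i : Fin 2 => if i = 0 then Set.univ else Set.Iio 0) ?_ ?_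
  · intro i
    fin_cases i
    · simpa using Set.infinite_univ
    · simpa using Set.Iio_infinite (0 : ℝ)
  · intro x hx
    have h1 : x 1 < 0 := by simpa using hx 1 (Set.mem_univ _)
    obtain ⟨r, hr, hrx⟩ : ∃ r : ℝ, r ≠ 0 ∧ x 1 = - r ^ 2 :=
      ⟨Real.sqrt (-x 1), (Real.sqrt_pos.mpr (by linarith)).ne', by
        rw [Real.sq_sqrt (by linarith)]; ring⟩
    have hxx : x = ![x 0, - r ^ 2] := by
      ext i; fin_cases i <;> simp [hrx]
    rw [hxx, aux_lucas_prod _ r hr n hn, aux_pair, auxA, Finset.prod_image, map_prod]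
    · refine Finset.prod_congr rfl fun j hj => ?_
      simp only [Finset.mem_filter, Finset.mem_Ico] at hj
      have hiff : ((j : ℚ) / n = 1 / 2) ↔ 2 * j = n := by
        rw [div_eq_div_iff hn0q.ne' two_ne_zero]
        constructor
        · intro h
          have : j * 2 = 1 * n := by exact_mod_cast h
          omega
        · rintro rfl
          push_cast; ring
      simp only [auxG, hiff]
      split_ifs with h2
      · have : (j : ℝ) / n = 1 / 2 := by
          rw [div_eq_div_iff hn0.ne' two_ne_zero, ← h2]; push_cast; ring
        rw [this]
        simp [show Real.pi * 2⁻¹ = Real.pi / 2 by ring]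
      · have : ((n - j : ℕ) : ℝ) = n - j := by
          rw [Nat.cast_sub (by omega)]
        rw [this, show Real.pi * ((n - j : ℝ) / n) = Real.pi - Real.pi * (j / n) by field_simp,
          Real.cos_pi_sub]
        simp
        ring
    · intro a _ b _ hab
      have := (div_left_inj' hn0q.ne').mp hab
      exact_mod_cast this

lemma aux_lucas_fac' (M n : ℕ) (hM : 1 ≤ M) (hn : 1 ≤ n) (h : n ∣ M) :
    map (Int.castRingHom ℝ) (lucas n) = ∏ q ∈ auxA M, auxG q ^ (if q.den ∣ n then 1 else 0) := by
  rw [aux_lucas_fac n hn]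
  have : auxA n = (auxA M).filter (fun q => q.den ∣ n) := by
    ext q
    rw [Finset.mem_filter, aux_mem hn, aux_mem hM]
    constructor
    · rintro ⟨a, b, c⟩; exact ⟨⟨a, b, c.trans h⟩, c⟩
    · rintro ⟨⟨a, b, _⟩, c⟩; exact ⟨a, b, c⟩
  rw [this, Finset.prod_filter]
  refine Finset.prod_congr rfl fun q _ => ?_
  split_ifs <;> simp

lemma aux_count (d k a : ℕ) (hk : 1 ≤ k) :
    (a + 1) / (d / d.gcd k) = a / (d / d.gcd k) + (if d ∣ (a + 1) * k then 1 else 0) := by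
  rw [Nat.succ_div]
  have hiff : d / d.gcd k ∣ a + 1 ↔ d ∣ (a + 1) * k := by
    have hg : 0 < d.gcd k := Nat.gcd_pos_of_pos_right _ hk
    have hd := Nat.div_mul_cancel (Nat.gcd_dvd_left d k)
    have hk' := Nat.div_mul_cancel (Nat.gcd_dvd_right d k)
    have hco : Nat.Coprime (d / d.gcd k) (k / d.gcd k) := Nat.coprime_div_gcd_div_gcd hg
    rw [← hco.dvd_mul_right (k := _) (n := _), ← Nat.mul_dvd_mul_iff_right hg, hd, mul_assoc, hk']
  simp only [hiff]

lemma aux_fact_fac (M k : ℕ) (hM : 1 ≤ M) (hk : 1 ≤ k) (a : ℕ)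
    (h : ∀ i, 1 ≤ i → i ≤ a → i * k ∣ M) :
    map (Int.castRingHom ℝ) (kLucasFact k a) =
      ∏ q ∈ auxA M, auxG q ^ (a / (q.den / q.den.gcd k)) := by
  induction a with
  | zero => simp [kLucasFact]
  | succ a ih =>
    rw [kLucasFact, map_mul, ih (fun i h1 h2 => h i h1 (by omega)),
      aux_lucas_fac' M _ hM (Nat.mul_pos (by omega) hk) (h _ (by omega) le_rfl),
      ← Finset.prod_mul_distrib]
    refine Finset.prod_congr rfl fun q _ => ?_
    rw [aux_count _ _ _ hk, pow_add, mul_comm]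

lemma aux_floor (m n d : ℕ) : m / d + n / d + (m + n) / d ≤ 2 * m / d + 2 * n / d := by
  rcases Nat.eq_zero_or_pos d with rfl | hd
  · simp
  have hm := Nat.div_add_mod m d
  have hn := Nat.div_add_mod n d
  have hm' := Nat.mod_lt m hd
  have hn' := Nat.mod_lt n hd
  set a := m / d
  set b := n / d
  set u := m % d
  set v := n % d
  have e1 : 2 * m / d = 2 * a + 2 * u / d := by
    rw [← hm, show 2 * (d * a + u) = 2 * u + d * (2 * a) by ring, Nat.add_mul_div_left _ _ hd]
    ring
  have e2 : 2 * n / d = 2 * b + 2 * v / d := by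
    rw [← hn, show 2 * (d * b + v) = 2 * v + d * (2 * b) by ring, Nat.add_mul_div_left _ _ hd]
    ring
  have e3 : (m + n) / d = a + b + (u + v) / d := by
    rw [← hm, ← hn, show (d * a + u) + (d * b + v) = (u + v) + d * (a + b) by ring,
      Nat.add_mul_div_left _ _ hd]
    ring
  have key : (u + v) / d ≤ 2 * u / d + 2 * v / d := by
    rcases le_total u v with h | h
    · exact (Nat.div_le_div_right (by omega)).trans (Nat.le_add_left _ _)
    · exact (Nat.div_le_div_right (by omega)).trans (Nat.le_add_right _ _)
  omega

/-- Real polynomials with nonnegative coefficients. -/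
def auxNN : Submonoid (MvPolynomial (Fin 2) ℝ) where
  carrier := {p | ∀ d, 0 ≤ p.coeff d}
  one_mem' := by
    intro d
    rw [coeff_one]
    split_ifs <;> norm_num
  mul_mem' := by
    intro p q hp hq d
    rw [coeff_mul]
    exact Finset.sum_nonneg fun x _ => mul_nonneg (hp _) (hq _)

lemma aux_G_nn (q : ℚ) : auxG q ∈ auxNN := by
  have hX : ∀ i, (X i : MvPolynomial (Fin 2) ℝ) ∈ auxNN := by
    intro i d
    rw [coeff_X']
    split_ifs <;> norm_num
  unfold auxG
  split_ifs
  · exact hX 0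
  · intro d
    rw [coeff_add, coeff_C_mul]
    have h1 := pow_mem (hX 0) 2 d
    have h2 := hX 1 d
    positivity

lemma aux_monic_lucas (n : ℕ) : (finSuccEquiv ℤ 1 (lucas (n + 1))).Monic ∧
    (finSuccEquiv ℤ 1 (lucas (n + 1))).natDegree = n := by
  induction n using Nat.twoStepInduction with
  | zero => simp [lucas]
  | one => simp [lucas, finSuccEquiv_X_zero]
  | more n h1 h2 =>
    rw [lucas, map_add, map_mul, map_mul, finSuccEquiv_X_zero,
      show (1 : Fin 2) = Fin.succ 0 from rfl, finSuccEquiv_X_succ]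
    have hm : (Polynomial.X * finSuccEquiv ℤ 1 (lucas (n + 1 + 1))).Monic :=
      Polynomial.monic_X.mul h2.1
    have hd : (Polynomial.X * finSuccEquiv ℤ 1 (lucas (n + 1 + 1))).natDegree = n + 2 := by
      rw [Polynomial.Monic.natDegree_mul Polynomial.monic_X h2.1, h2.2, Polynomial.natDegree_X]
      omega
    have hlt : (Polynomial.C (X 0) * finSuccEquiv ℤ 1 (lucas (n + 1))).degree <
        (Polynomial.X * finSuccEquiv ℤ 1 (lucas (n + 1 + 1))).degree := by
      apply Polynomial.degree_lt_degree
      rw [hd]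
      have := Polynomial.natDegree_C_mul_le (X 0 : MvPolynomial (Fin 1) ℤ)
        (finSuccEquiv ℤ 1 (lucas (n + 1)))
      omega
    exact ⟨hm.add_of_left hlt, by rw [Polynomial.natDegree_add_eq_left_of_degree_lt hlt, hd]⟩

lemma aux_monic_fact (k : ℕ) (hk : 1 ≤ k) (a : ℕ) :
    (finSuccEquiv ℤ 1 (kLucasFact k a)).Monic := by
  induction a with
  | zero => simp [kLucasFact]
  | succ a ih =>
    rw [kLucasFact, map_mul]
    obtain ⟨c, hc⟩ := Nat.exists_eq_add_of_le' (Nat.mul_pos (Nat.succ_pos a) hk)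
    refine Polynomial.Monic.mul ?_ ih
    have := (aux_monic_lucas c).1
    rw [show (a + 1) * k = c + 1 from hc]
    exact this

lemma aux_int (N D : MvPolynomial (Fin 2) ℤ) (Q : MvPolynomial (Fin 2) ℝ)
    (hD : (finSuccEquiv ℤ 1 D).Monic)
    (h : map (Int.castRingHom ℝ) N = Q * map (Int.castRingHom ℝ) D) :
    ∃ p, map (Int.castRingHom ℝ) p = Q ∧ N = p * D := by
  have hinj : Function.Injective (Int.castRingHom ℝ) := Int.cast_injective
  have hcomm : ∀ p : MvPolynomial (Fin 2) ℤ,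
      Polynomial.map (map (Int.castRingHom ℝ)) (finSuccEquiv ℤ 1 p) =
        finSuccEquiv ℝ 1 (map (Int.castRingHom ℝ) p) := by
    intro p
    ext i m
    rw [Polynomial.coeff_map, coeff_map, finSuccEquiv_coeff_coeff, finSuccEquiv_coeff_coeff,
      coeff_map]
  have hdvd : finSuccEquiv ℤ 1 D ∣ finSuccEquiv ℤ 1 N := by
    rw [← Polynomial.modByMonic_eq_zero_iff_dvd hD]
    apply Polynomial.map_injective _ (map_injective (σ := Fin 1) _ hinj)
    rw [Polynomial.map_modByMonic _ hD, Polynomial.map_zero,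
      Polynomial.modByMonic_eq_zero_iff_dvd (hD.map _), hcomm, hcomm, h, map_mul]
    exact dvd_mul_left _ _
  have hdvd' : D ∣ N := (map_dvd_iff (finSuccEquiv ℤ 1)).mp hdvd
  obtain ⟨p, rfl⟩ := hdvd'
  refine ⟨p, ?_, mul_comm _ _⟩
  have hD0 : map (Int.castRingHom ℝ) D ≠ 0 := by
    intro h0
    have : D = 0 := map_injective _ hinj (by rw [h0, map_zero])
    rw [this, map_zero] at hD
    exact hD.ne_zero rfl
  rw [map_mul, mul_comm] at h
  exact mul_right_cancel₀ hD0 h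

/-- For `k ≥ 1`, the `k`-divisible Lucanomial analogue of the super Catalan number
`S{m,n:k} = {2m:k}!·{2n:k}!/({m:k}!·{n:k}!·{m+n:k}!)` is a polynomial with nonnegative
integer coefficients. -/
theorem kDivisible_superCatalan_poly (k m n : ℕ) (hk : 1 ≤ k) :
    ∃ p : MvPolynomial (Fin 2) ℤ, (∀ d, 0 ≤ p.coeff d) ∧
      kLucasFact k (2 * m) * kLucasFact k (2 * n)
        = p * (kLucasFact k m * kLucasFact k n * kLucasFact k (m + n)) := by
  obtain ⟨M, hM⟩ : ∃ M, M = ((2 * m + 2 * n) * k).factorial := ⟨_, rfl⟩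
  have hM1 : 1 ≤ M := hM ▸ Nat.factorial_pos _
  have hf : ∀ a, a ≤ 2 * m + 2 * n → map (Int.castRingHom ℝ) (kLucasFact k a) =
      ∏ q ∈ auxA M, auxG q ^ (a / (q.den / q.den.gcd k)) := by
    intro a ha
    refine aux_fact_fac M k hM1 hk a fun i h1 h2 => ?_
    rw [hM]
    exact Nat.dvd_factorial (Nat.mul_pos h1 hk) (Nat.mul_le_mul_right k (h2.trans ha))
  obtain ⟨p, hp, hpN⟩ := aux_int (kLucasFact k (2 * m) * kLucasFact k (2 * n))
    (kLucasFact k m * kLucasFact k n * kLucasFact k (m + n))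
    (∏ q ∈ auxA M, auxG q ^ ((2 * m) / (q.den / q.den.gcd k) + (2 * n) / (q.den / q.den.gcd k)
      - (m / (q.den / q.den.gcd k) + n / (q.den / q.den.gcd k) + (m + n) / (q.den / q.den.gcd k))))
    (by
      rw [map_mul, map_mul]
      exact ((aux_monic_fact k hk m).mul (aux_monic_fact k hk n)).mul (aux_monic_fact k hk (m + n)))
    (by
      simp only [map_mul]
      rw [hf _ (by omega), hf _ (by omega), hf _ (by omega), hf _ (by omega), hf _ (by omega)]
      simp only [← Finset.prod_mul_distrib, ← pow_add]
      refine Finset.prod_congr rfl fun q _ => ?_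
      rw [Nat.sub_add_cancel (aux_floor _ _ _)])
  refine ⟨p, fun d => ?_, hpN⟩
  have hnn : map (Int.castRingHom ℝ) p ∈ auxNN := by
    rw [hp]
    exact prod_mem fun q _ => pow_mem (aux_G_nn q) _
  have := hnn d
  rw [coeff_map] at this
  simpa using this
end
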